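/- Let γ ∈ [−3,−2). Each entry ā_{ij} is a C^∞ function on ℝ³, and for every n ∈ ℕ there exists a constant C_n > 0 such that for all v ∈ ℝ³ and all i,j, the n-th iterated derivative of ā_{ij} satisfies ‖D^n ā_{ij}(v)‖ ≤ C_n ⟨v⟩^{γ+2−n}. -/

import Mathlib

noncomputable section

open MeasureTheory Real Filter

abbrev V3 := EuclideanSpace ℝ (Fin 3)

/-- Japanese bracket ⟨v⟩ = (1+|v|²)^{1/2}. -/
def jap (v : V3) : ℝ := Real.sqrt (1 + ‖v‖ ^ 2)

/-- Standard Gaussian μ on ℝ³. -/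
def gaussM (v : V3) : ℝ := (2 * Real.pi) ^ (-(3 : ℝ) / 2) * Real.exp (-‖v‖ ^ 2 / 2)

/-- Landau kernel matrix a_{ij}(z). -/
def aker (γ : ℝ) (z : V3) (i j : Fin 3) : ℝ :=
  ‖z‖ ^ (γ + 2) * ((if i = j then (1 : ℝ) else 0) - z i * z j / ‖z‖ ^ 2)

/-- ā_{ij} = a_{ij} * μ. -/
def abar (γ : ℝ) (v : V3) (i j : Fin 3) : ℝ := ∫ w : V3, aker γ (v - w) i j * gaussM w

def bker (γ : ℝ) (z : V3) (i : Fin 3) : ℝ := -2 * ‖z‖ ^ γ * z i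

/-- b̄_i = b_i * μ. -/
def bbar (γ : ℝ) (v : V3) (i : Fin 3) : ℝ := ∫ w : V3, bker γ (v - w) i * gaussM w

/-- J_β(v) = ∫ |v−w|^β μ(w) dw. -/
def Jfun (β : ℝ) (v : V3) : ℝ := ∫ w : V3, ‖v - w‖ ^ β * gaussM w

/-- c̄(v) = −2(γ+3) J_γ(v). -/
def cbar (γ : ℝ) (v : V3) : ℝ := -2 * (γ + 3) * Jfun γ v

/-- ℓ₁(v). -/
def ell1 (γ : ℝ) (v : V3) : ℝ :=
  ∫ w : V3, (1 - ((∑ i, v i * w i) / (‖v‖ * ‖w‖)) ^ 2) * ‖w‖ ^ (γ + 2) * gaussM (v - w)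

/-- Squared Euclidean norm of the cross product of two vectors in ℝ³. -/
def crossSq (a b : V3) : ℝ :=
  ∑ i, (crossProduct (R := ℝ) (fun k => a k) (fun k => b k) i) ^ 2

/-- ℓ₂(v). -/
def ell2 (γ : ℝ) (v : V3) : ℝ :=
  ∫ w : V3,
    (1 - (1 / 2) * crossSq (‖v‖⁻¹ • v) (‖w‖⁻¹ • w)) * ‖w‖ ^ (γ + 2) * gaussM (v - w)

/-- Projection P_v ξ on the direction v. -/
def Pv (v ξ : V3) : V3 := ((∑ i, ξ i * v i) / ‖v‖ ^ 2) • v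

/-- Partial derivative in the i-th coordinate direction. -/
def pd (i : Fin 3) (f : V3 → ℝ) : V3 → ℝ := fun v => fderiv ℝ f v (EuclideanSpace.single i 1)

/-- Anisotropic gradient ∇̃f = P_v ∇f + ⟨v⟩ (I − P_v) ∇f. -/
def anisoGrad (f : V3 → ℝ) (v : V3) : V3 :=
  Pv v (gradient f v) + jap v • (gradient f v - Pv v (gradient f v))

/-- The filter |v| → ∞ on ℝ³. -/
def normAtTop : Filter V3 := Filter.comap (fun v : V3 => ‖v‖) Filter.atTop

universe u

open scoped ContDiff

section Convolution

variable {E F : Type u} [NormedAddCommGroup E] [MeasurableSpace E] [BorelSpace E]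
  [SecondCountableTopology E] {ν : Measure E} {g : E → ℝ}
  [NormedAddCommGroup F] [NormedSpace ℝ F]

lemma integrable_smul_comp_sub (hg : Integrable g ν) {h : E → F} (hh : Continuous h)
    {B : ℝ} (hB : ∀ z, ‖h z‖ ≤ B) (v : E) : Integrable (fun w => g w • h (v - w)) ν :=
  hg.smul_bdd B (hh.comp (continuous_const.sub continuous_id)).aestronglyMeasurable
    (Eventually.of_forall fun _ => hB _)

variable [NormedSpace ℝ E]

lemma hasFDerivAt_integral_smul_comp_sub (hg : Integrable g ν) {h : E → F} (hh : ContDiff ℝ 1 h)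
    {B₀ B₁ : ℝ} (hB₀ : ∀ z, ‖h z‖ ≤ B₀) (hB₁ : ∀ z, ‖fderiv ℝ h z‖ ≤ B₁) (v : E) :
    HasFDerivAt (fun v => ∫ w, g w • h (v - w) ∂ν) (∫ w, g w • fderiv ℝ h (v - w) ∂ν) v := by
  refine hasFDerivAt_integral_of_dominated_of_fderiv_le (s := Set.univ)
    (F' := fun v w => g w • fderiv ℝ h (v - w)) (bound := fun w => ‖g w‖ * B₁) univ_mem
    (Eventually.of_forall fun v =>
      (integrable_smul_comp_sub hg hh.continuous hB₀ v).aestronglyMeasurable)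
    (integrable_smul_comp_sub hg hh.continuous hB₀ v)
    (integrable_smul_comp_sub hg (hh.continuous_fderiv one_ne_zero) hB₁ v).aestronglyMeasurable
    (Eventually.of_forall fun w x _ => ?_) (hg.norm.mul_const _)
    (Eventually.of_forall fun w x _ => ?_)
  · rw [norm_smul]
    gcongr
    exact hB₁ _
  · have := ((hh.differentiable one_ne_zero (x - w)).hasFDerivAt.comp x
      ((hasFDerivAt_id x).sub_const w)).const_smul (g w)
    simp only [id_eq, ContinuousLinearMap.comp_id] at this
    exact this

lemma contDiff_integral_smul_comp_sub (hg : Integrable g ν) (n : ℕ) {F : Type u}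
    [NormedAddCommGroup F] [NormedSpace ℝ F] {h : E → F} (hh : ContDiff ℝ ∞ h)
    (hB : ∀ k, ∃ B, ∀ z, ‖iteratedFDeriv ℝ k h z‖ ≤ B) :
    ContDiff ℝ n (fun v => ∫ w, g w • h (v - w) ∂ν) ∧
      ∀ v, ‖iteratedFDeriv ℝ n (fun v => ∫ w, g w • h (v - w) ∂ν) v‖ ≤
        ∫ w, ‖g w‖ * ‖iteratedFDeriv ℝ n h (v - w)‖ ∂ν := by
  have hder : ∀ v, HasFDerivAt (fun v => ∫ w, g w • h (v - w) ∂ν)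
      (∫ w, g w • fderiv ℝ h (v - w) ∂ν) v := by
    obtain ⟨B₀, hB₀⟩ := hB 0
    obtain ⟨B₁, hB₁⟩ := hB 1
    refine hasFDerivAt_integral_smul_comp_sub hg (hh.of_le (by simp))
      (B₀ := B₀) (B₁ := B₁) (fun z => by simpa using hB₀ z) fun z => ?_
    simpa [← norm_iteratedFDeriv_fderiv] using hB₁ z
  induction n generalizing F with
  | zero =>
    refine ⟨contDiff_zero.2 (continuous_iff_continuousAt.2 fun v => (hder v).continuousAt),
      fun v => ?_⟩
    simp only [norm_iteratedFDeriv_zero, ← norm_smul]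
    exact norm_integral_le_integral_norm _
  | succ n ih =>
    have hf : fderiv ℝ (fun v => ∫ w, g w • h (v - w) ∂ν) =
        fun v => ∫ w, g w • fderiv ℝ h (v - w) ∂ν := funext fun v => (hder v).fderiv
    have hh' : ContDiff ℝ ∞ (fderiv ℝ h) := hh.fderiv_right (by simp)
    have hB' : ∀ k, ∃ B, ∀ z, ‖iteratedFDeriv ℝ k (fderiv ℝ h) z‖ ≤ B := fun k => by
      simpa only [norm_iteratedFDeriv_fderiv] using hB (k + 1)
    obtain ⟨h₁, h₂⟩ := ih hh' hB' (by
      obtain ⟨B₀, hB₀⟩ := hB' 0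
      obtain ⟨B₁, hB₁⟩ := hB' 1
      refine hasFDerivAt_integral_smul_comp_sub hg (hh'.of_le (by simp))
        (B₀ := B₀) (B₁ := B₁) (fun z => by simpa using hB₀ z) fun z => ?_
      simpa [← norm_iteratedFDeriv_fderiv] using hB₁ z)
    refine ⟨?_, fun v => ?_⟩
    · rw [Nat.cast_add, Nat.cast_one, contDiff_succ_iff_fderiv]
      exact ⟨fun v => (hder v).differentiableAt, by simp, by rwa [hf]⟩
    · rw [← norm_iteratedFDeriv_fderiv, hf]
      simpa only [norm_iteratedFDeriv_fderiv] using h₂ v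

end Convolution

lemma one_add_norm_sub_rpow_le {E : Type*} [SeminormedAddCommGroup E] {p : ℝ} (hp : p ≤ 0)
    (v w : E) : (1 + ‖v - w‖) ^ p ≤ (1 + ‖v‖) ^ p * (1 + ‖w‖) ^ (-p) := by
  have h : 1 + ‖v‖ ≤ (1 + ‖v - w‖) * (1 + ‖w‖) := by
    have := norm_sub_norm_le v w
    nlinarith [norm_nonneg (v - w), norm_nonneg w, mul_nonneg (norm_nonneg (v - w)) (norm_nonneg w)]
  have h2 := rpow_le_rpow_of_nonpos (by positivity) h hp
  rw [mul_rpow (by positivity) (by positivity)] at h2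
  rw [rpow_neg (by positivity), ← div_eq_mul_inv, le_div_iff₀ (by positivity)]
  exact h2

/-- Convolving with a function having enough moments preserves polynomial decay of derivatives. -/
lemma norm_iteratedFDeriv_integral_smul_comp_sub_le {E F : Type u} [NormedAddCommGroup E]
    [NormedSpace ℝ E] [MeasurableSpace E] [BorelSpace E] [SecondCountableTopology E]
    [NormedAddCommGroup F] [NormedSpace ℝ F] {ν : Measure E} {g : E → ℝ} (hg : Integrable g ν)
    {h : E → F} (hh : ContDiff ℝ ∞ h) (hB : ∀ k, ∃ B, ∀ z, ‖iteratedFDeriv ℝ k h z‖ ≤ B)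
    {n : ℕ} {p C : ℝ} (hp : p ≤ 0) (hgp : Integrable (fun w => ‖g w‖ * (1 + ‖w‖) ^ (-p)) ν)
    (hC : ∀ z, ‖iteratedFDeriv ℝ n h z‖ ≤ C * (1 + ‖z‖) ^ p) (v : E) :
    ‖iteratedFDeriv ℝ n (fun v => ∫ w, g w • h (v - w) ∂ν) v‖ ≤
      (C * ∫ w, ‖g w‖ * (1 + ‖w‖) ^ (-p) ∂ν) * (1 + ‖v‖) ^ p := by
  have hC0 : 0 ≤ C := by
    have := (norm_nonneg _).trans (hC 0)
    simpa using this
  refine ((contDiff_integral_smul_comp_sub hg n hh hB).2 v).trans ?_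
  rw [mul_right_comm, ← integral_const_mul]
  refine integral_mono_of_nonneg (Eventually.of_forall fun w => by positivity)
    (hgp.const_mul _) (Eventually.of_forall fun w => ?_)
  calc ‖g w‖ * ‖iteratedFDeriv ℝ n h (v - w)‖
      ≤ ‖g w‖ * (C * ((1 + ‖v‖) ^ p * (1 + ‖w‖) ^ (-p))) := by
        gcongr
        refine (hC _).trans ?_
        gcongr
        exact one_add_norm_sub_rpow_le hp v w
    _ = _ := by ring

/-! ### Decay of the Gaussian and its derivatives -/

lemma one_add_pow_mul_exp_neg_sq_le (m : ℕ) {r : ℝ} (hr : 0 ≤ r) :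
    (1 + r) ^ m * exp (-r ^ 2 / 2) ≤ m.factorial * exp (3 / 2) := by
  have h₁ : (1 + r) ^ m ≤ m.factorial * exp (1 + r) := by
    have := pow_div_factorial_le_exp (x := 1 + r) (by positivity) m
    rwa [div_le_iff₀' (by positivity)] at this
  have h₂ : exp (1 + r) * exp (-r ^ 2 / 2) ≤ exp (3 / 2) := by
    rw [← exp_add]
    exact exp_le_exp.2 (by nlinarith [sq_nonneg (r - 1)])
  calc (1 + r) ^ m * exp (-r ^ 2 / 2) ≤ m.factorial * exp (1 + r) * exp (-r ^ 2 / 2) := by gcongr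
    _ = m.factorial * (exp (1 + r) * exp (-r ^ 2 / 2)) := by ring
    _ ≤ _ := by gcongr

lemma gaussM_nonneg (v : V3) : 0 ≤ gaussM v := by
  unfold gaussM; positivity

lemma contDiff_gaussM : ContDiff ℝ ∞ gaussM := by
  unfold gaussM
  exact contDiff_const.mul (((contDiff_norm_sq ℝ).neg.div_const 2).exp)

lemma norm_iteratedFDeriv_gaussM_le (n m : ℕ) :
    ∃ C, ∀ v, (1 + ‖v‖) ^ m * ‖iteratedFDeriv ℝ n gaussM v‖ ≤ C := by
  set c : ℝ := (2 * Real.pi) ^ (-(3 : ℝ) / 2)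
  set q : V3 → ℝ := fun v => -‖v‖ ^ 2 / 2 with hq_def
  have hq : q.HasTemperateGrowth := by
    have := (Function.hasTemperateGrowth_norm_sq V3).mul (.const (-1 / 2 : ℝ))
    convert! this using 1
    funext v
    simp only [hq_def, Pi.mul_apply]
    ring
  have hqs : ContDiff ℝ ∞ q := (contDiff_norm_sq ℝ).neg.div_const 2
  obtain ⟨k, D, hD, hqD⟩ := hq.norm_iteratedFDeriv_le_uniform n
  refine ⟨|c| * (n.factorial * (D + 1) ^ n * ((m + k * n).factorial * exp (3 / 2))), fun v => ?_⟩
  have h₁ : ‖iteratedFDeriv ℝ n (rexp ∘ q) v‖ ≤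
      n.factorial * exp (q v) * ((D + 1) * (1 + ‖v‖) ^ k) ^ n := by
    refine norm_iteratedFDeriv_comp_le contDiff_exp hqs (mod_cast le_top) v
      (fun i _ => ?_) (fun i hi hin => ?_)
    · rw [norm_iteratedFDeriv_eq_norm_iteratedDeriv, iteratedDeriv_eq_iterate, iter_deriv_exp]
      simp
    · have h1 : (1 : ℝ) ≤ (1 + ‖v‖) ^ k := one_le_pow₀ (by simp)
      have h2 : (1 : ℝ) ≤ (D + 1) * (1 + ‖v‖) ^ k := by nlinarith
      calc _ ≤ D * (1 + ‖v‖) ^ k := hqD i hin v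
        _ ≤ (D + 1) * (1 + ‖v‖) ^ k := by gcongr; simp
        _ ≤ _ := le_self_pow₀ h2 (by omega)
  have h₂ : iteratedFDeriv ℝ n gaussM v = c • iteratedFDeriv ℝ n (rexp ∘ q) v :=
    iteratedFDeriv_const_smul_apply' (f := rexp ∘ q) (a := c)
      ((contDiff_exp.comp hqs).of_le (mod_cast le_top)).contDiffAt
  rw [h₂, norm_smul, norm_eq_abs]
  calc (1 + ‖v‖) ^ m * (|c| * ‖iteratedFDeriv ℝ n (rexp ∘ q) v‖)
      ≤ (1 + ‖v‖) ^ m * (|c| * (n.factorial * exp (q v) * ((D + 1) * (1 + ‖v‖) ^ k) ^ n)) := by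
        gcongr
    _ = |c| * (n.factorial * (D + 1) ^ n * ((1 + ‖v‖) ^ (m + k * n) * exp (-‖v‖ ^ 2 / 2))) := by
        rw [mul_pow, ← pow_mul, pow_add]; ring
    _ ≤ _ := by
        refine mul_le_mul_of_nonneg_left (mul_le_mul_of_nonneg_left ?_ (by positivity)) (abs_nonneg c)
        exact one_add_pow_mul_exp_neg_sq_le _ (norm_nonneg v)

lemma norm_iteratedFDeriv_gaussM_le_rpow (n : ℕ) (p : ℝ) :
    ∃ C, ∀ v, ‖iteratedFDeriv ℝ n gaussM v‖ ≤ C * (1 + ‖v‖) ^ p := by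
  obtain ⟨m, hm⟩ := exists_nat_ge (-p)
  obtain ⟨C, hC⟩ := norm_iteratedFDeriv_gaussM_le n m
  refine ⟨C, fun v => ?_⟩
  have h : (1 + ‖v‖) ^ (-p) ≤ (1 + ‖v‖) ^ m := by
    rw [← rpow_natCast]
    exact rpow_le_rpow_of_exponent_le (by simp) hm
  have h' : (1 + ‖v‖) ^ (-p) * ‖iteratedFDeriv ℝ n gaussM v‖ ≤ C :=
    (by gcongr : _ ≤ (1 + ‖v‖) ^ m * ‖iteratedFDeriv ℝ n gaussM v‖).trans (hC v)
  rw [rpow_neg (by positivity), inv_mul_le_iff₀ (by positivity)] at h'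
  rwa [mul_comm]

lemma continuous_one_add_norm_rpow {E : Type*} [SeminormedAddCommGroup E] (q : ℝ) :
    Continuous fun w : E => (1 + ‖w‖) ^ q :=
  Continuous.rpow_const (by fun_prop) fun w => .inl (by positivity : (0 : ℝ) < 1 + ‖w‖).ne'

lemma integrable_gaussM_mul_rpow (q : ℝ) :
    Integrable (fun w : V3 => ‖gaussM w‖ * (1 + ‖w‖) ^ q) := by
  obtain ⟨C, hC⟩ := norm_iteratedFDeriv_gaussM_le_rpow 0 (-q - 4)
  have h4 : Integrable (fun w : V3 => (1 + ‖w‖) ^ (-4 : ℝ)) :=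
    integrable_one_add_norm (by norm_num)
  have hcont : Continuous fun w : V3 => ‖gaussM w‖ * (1 + ‖w‖) ^ q :=
    contDiff_gaussM.continuous.norm.mul (continuous_one_add_norm_rpow q)
  refine (h4.const_mul C).mono' hcont.aestronglyMeasurable (Eventually.of_forall fun w => ?_)
  have h := hC w
  rw [norm_iteratedFDeriv_zero] at h
  have h0 : 0 ≤ ‖gaussM w‖ * (1 + ‖w‖) ^ q := by positivity
  rw [norm_of_nonneg h0]
  calc ‖gaussM w‖ * (1 + ‖w‖) ^ q ≤ C * (1 + ‖w‖) ^ (-q - 4) * (1 + ‖w‖) ^ q := by gcongr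
    _ = _ := by rw [mul_assoc, ← rpow_add (show 0 < 1 + ‖w‖ by positivity)]; ring_nf

lemma integrable_gaussM : Integrable gaussM := by
  have h := integrable_gaussM_mul_rpow 0
  simp only [rpow_zero, mul_one] at h
  exact (integrable_norm_iff contDiff_gaussM.continuous.aestronglyMeasurable).1 h

/-! ### Homogeneous functions -/

lemma exists_norm_iteratedFDeriv_le_of_homogeneous {E F : Type*} [NormedAddCommGroup E]
    [NormedSpace ℝ E] [FiniteDimensional ℝ E] [NormedAddCommGroup F] [NormedSpace ℝ F]
    {f : E → F} {s : ℝ} (hf : ∀ z ≠ 0, ContDiffAt ℝ ∞ f z)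
    (hom : ∀ t : ℝ, 0 < t → ∀ z, f (t • z) = (t ^ s : ℝ) • f z) (n : ℕ) :
    ∃ C, ∀ z ≠ 0, ‖iteratedFDeriv ℝ n f z‖ ≤ C * ‖z‖ ^ (s - n) := by
  have hcont : ContinuousOn (fun z => ‖iteratedFDeriv ℝ n f z‖) (Metric.sphere 0 1) := by
    refine fun z hz => (ContinuousAt.norm ?_).continuousWithinAt
    exact (hf z (ne_zero_of_mem_unit_sphere ⟨z, hz⟩)).continuousAt_iteratedFDeriv
      (mod_cast le_top)
  obtain ⟨C, hC⟩ := (isCompact_sphere (0 : E) 1).bddAbove_image hcont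
  refine ⟨C, fun z hz => ?_⟩
  have hz0 : 0 < ‖z‖ := norm_pos_iff.2 hz
  set e : E := ‖z‖⁻¹ • z with he
  have he1 : e ∈ Metric.sphere (0 : E) 1 := by simp [he, norm_smul, hz0.ne']
  have hze : ‖z‖ • e = z := by rw [he, smul_smul, mul_inv_cancel₀ hz0.ne', one_smul]
  let T : E ≃L[ℝ] E := ContinuousLinearEquiv.smulLeft (Units.mk0 ‖z‖ hz0.ne')
  have h₁ : iteratedFDeriv ℝ n (f ∘ T) e =
      (iteratedFDeriv ℝ n f (T e)).compContinuousLinearMap fun _ => (T : E →L[ℝ] E) := by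
    simpa only [iteratedFDerivWithin_univ, Set.preimage_univ] using
      T.iteratedFDerivWithin_comp_right f uniqueDiffOn_univ (Set.mem_univ (T e)) n
  have h₂ : f ∘ T = fun x => (‖z‖ ^ s : ℝ) • f x := funext fun x => hom _ hz0 x
  have hTe : T e = z := hze
  rw [h₂, iteratedFDeriv_const_smul_apply' ((hf e (ne_zero_of_mem_unit_sphere ⟨e, he1⟩)).of_le
    (mod_cast le_top)), hTe] at h₁
  have h₃ : ((iteratedFDeriv ℝ n f z).compContinuousLinearMap fun _ => (T : E →L[ℝ] E)) =
      ‖z‖ ^ n • iteratedFDeriv ℝ n f z := by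
    ext m
    have h := (iteratedFDeriv ℝ n f z).map_smul_univ (fun _ => ‖z‖) m
    simp only [Finset.prod_const, Finset.card_univ, Fintype.card_fin] at h
    exact h
  rw [h₃] at h₁
  have h₄ := congrArg norm h₁
  rw [norm_smul, norm_smul, norm_of_nonneg (by positivity), norm_of_nonneg (by positivity)] at h₄
  have h₅ : ‖iteratedFDeriv ℝ n f e‖ ≤ C := hC ⟨e, he1, rfl⟩
  rw [rpow_sub hz0, rpow_natCast, ← mul_div_assoc, le_div_iff₀ (by positivity), mul_comm, ← h₄,
    mul_comm]
  gcongr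

/-- A bounded smooth function which is homogeneous of nonpositive degree off a ball. -/
lemma exists_norm_iteratedFDeriv_le_of_eq_homogeneous {E F : Type*} [NormedAddCommGroup E]
    [NormedSpace ℝ E] [FiniteDimensional ℝ E] [NormedAddCommGroup F] [NormedSpace ℝ F]
    {f h : E → F} {s R : ℝ} (hs : s ≤ 0) (hR : 1 ≤ R) (hf : ∀ z ≠ 0, ContDiffAt ℝ ∞ f z)
    (hom : ∀ t : ℝ, 0 < t → ∀ z, f (t • z) = (t ^ s : ℝ) • f z) (hh : ContDiff ℝ ∞ h)
    (hfh : ∀ z, R < ‖z‖ → h z = f z) (n : ℕ) :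
    ∃ C, ∀ z, ‖iteratedFDeriv ℝ n h z‖ ≤ C * (1 + ‖z‖) ^ (s - n) := by
  have hp : s - n ≤ 0 := by have := n.cast_nonneg (α := ℝ); linarith
  obtain ⟨C₁, hC₁⟩ := exists_norm_iteratedFDeriv_le_of_homogeneous hf hom n
  obtain ⟨C₂, hC₂⟩ := (isCompact_closedBall (0 : E) R).bddAbove_image
    (f := fun z => ‖iteratedFDeriv ℝ n h z‖)
    (hh.continuous_iteratedFDeriv (mod_cast le_top)).norm.continuousOn
  have hfac (z : E) : 1 ≤ (1 + ‖z‖) ^ (s - n) * (1 + ‖z‖) ^ (n - s) := by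
    rw [← rpow_add (by positivity)]
    simp
  refine ⟨max (|C₁| * 2 ^ (n - s)) (|C₂| * (1 + R) ^ (n - s)), fun z => ?_⟩
  rcases lt_or_ge R ‖z‖ with hz | hz
  · have hz0 : 0 < ‖z‖ := by linarith
    have heq : h =ᶠ[nhds z] f := by
      filter_upwards [(isOpen_lt continuous_const continuous_norm).mem_nhds hz] with y hy
      exact hfh y hy
    rw [heq.iteratedFDeriv ℝ n |>.eq_of_nhds]
    have h2 : (2 * ‖z‖) ^ (s - n) ≤ (1 + ‖z‖) ^ (s - n) :=
      rpow_le_rpow_of_nonpos (by positivity) (by linarith) hp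
    rw [mul_rpow (by norm_num) hz0.le] at h2
    have h3 : (2 : ℝ) ^ (n - s) * 2 ^ (s - n) = 1 := by
      rw [← rpow_add (by norm_num)]; simp
    calc ‖iteratedFDeriv ℝ n f z‖ ≤ C₁ * ‖z‖ ^ (s - n) := hC₁ z (norm_pos_iff.1 hz0)
      _ ≤ |C₁| * ‖z‖ ^ (s - n) := by gcongr; exact le_abs_self _
      _ = |C₁| * 2 ^ (n - s) * (2 ^ (s - n) * ‖z‖ ^ (s - n)) := by
        linear_combination (-|C₁| * ‖z‖ ^ (s - n)) * h3
      _ ≤ |C₁| * 2 ^ (n - s) * (1 + ‖z‖) ^ (s - n) := by gcongr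
      _ ≤ _ := by gcongr; exact le_max_left _ _
  · have h4 : ‖iteratedFDeriv ℝ n h z‖ ≤ C₂ := hC₂ ⟨z, by simpa using hz, rfl⟩
    calc ‖iteratedFDeriv ℝ n h z‖ ≤ |C₂| * 1 := by rw [mul_one]; exact h4.trans (le_abs_self _)
      _ ≤ |C₂| * ((1 + ‖z‖) ^ (s - n) * (1 + R) ^ (n - s)) := by
        gcongr
        refine (hfac z).trans ?_
        gcongr
        linarith
      _ = |C₂| * (1 + R) ^ (n - s) * (1 + ‖z‖) ^ (s - n) := by ring
      _ ≤ _ := by gcongr; exact le_max_right _ _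

/-! ### The Landau kernel -/

lemma aker_smul {γ : ℝ} (hγ : γ < -2) {t : ℝ} (ht : 0 < t) (z : V3) (i j : Fin 3) :
    aker γ (t • z) i j = t ^ (γ + 2) • aker γ z i j := by
  rcases eq_or_ne z 0 with rfl | hz
  · simp [aker, zero_rpow (by linarith : γ + 2 ≠ 0)]
  · have hz' : ‖z‖ ≠ 0 := norm_ne_zero_iff.2 hz
    simp only [aker, norm_smul, norm_of_nonneg ht.le, PiLp.smul_apply, smul_eq_mul]
    rw [mul_rpow ht.le (norm_nonneg z)]
    field_simp

lemma contDiffAt_aker (γ : ℝ) {z : V3} (hz : z ≠ 0) (i j : Fin 3) :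
    ContDiffAt ℝ ∞ (fun z => aker γ z i j) z := by
  have hn : ContDiffAt ℝ ∞ (fun z : V3 => ‖z‖) z := contDiffAt_norm ℝ hz
  have hc (k : Fin 3) : ContDiffAt ℝ ∞ (fun z : V3 => z k) z :=
    (EuclideanSpace.proj k : V3 →L[ℝ] ℝ).contDiff.contDiffAt
  unfold aker
  exact (hn.rpow_const_of_ne (norm_ne_zero_iff.2 hz)).mul
    (contDiffAt_const.sub (((hc i).mul (hc j)).div (hn.pow 2)
      (pow_ne_zero 2 (norm_ne_zero_iff.2 hz))))

lemma abs_aker_le (γ : ℝ) (z : V3) (i j : Fin 3) : |aker γ z i j| ≤ 2 * ‖z‖ ^ (γ + 2) := by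
  rw [aker, abs_mul, abs_of_nonneg (by positivity), mul_comm]
  gcongr
  refine (abs_sub _ _).trans ?_
  have h₁ : |(if i = j then (1 : ℝ) else 0)| ≤ 1 := by split_ifs <;> simp
  have h₂ : |z i * z j / ‖z‖ ^ 2| ≤ 1 := by
    rw [abs_div, abs_mul, abs_of_nonneg (sq_nonneg ‖z‖)]
    refine div_le_one_of_le₀ ?_ (by positivity)
    rw [sq]
    have := PiLp.norm_apply_le z i
    have := PiLp.norm_apply_le z j
    simp only [norm_eq_abs] at *
    gcongr
  linarith

lemma measurable_aker (γ : ℝ) (i j : Fin 3) : Measurable (fun z => aker γ z i j) := by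
  unfold aker
  fun_prop

lemma integrableOn_norm_rpow_ball {s : ℝ} (hs : -3 < s) (r : ℝ) :
    IntegrableOn (fun z : V3 => ‖z‖ ^ s) (Metric.ball 0 r) := by
  rw [integrableOn_fun_norm_addHaar volume (f := fun r => r ^ s)]
  rcases le_or_gt r 0 with hr | hr
  · simp [Set.Ioo_eq_empty (not_lt.2 hr)]
  have h : IntegrableOn (fun y : ℝ => y ^ (2 + s)) (Set.Ioo 0 r) :=
    (intervalIntegral.integrableOn_Ioo_rpow_iff hr).2 (by linarith)
  refine h.congr_fun (fun y hy => ?_) measurableSet_Ioo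
  simp [rpow_add hy.1]

lemma integrable_bump_mul_aker {γ : ℝ} (hγ : -5 < γ) (χ : ContDiffBump (0 : V3)) (i j : Fin 3) :
    Integrable (fun z => χ z * aker γ z i j) := by
  have h := (integrableOn_norm_rpow_ball (s := γ + 2) (by linarith) χ.rOut).integrable_indicator
    Metric.isOpen_ball.measurableSet
  refine (h.const_mul 2).mono'
    (χ.continuous.measurable.mul (measurable_aker γ i j)).aestronglyMeasurable
    (Eventually.of_forall fun z => ?_)
  by_cases hz : z ∈ Metric.ball (0 : V3) χ.rOut
  · rw [Set.indicator_of_mem hz, norm_mul, norm_of_nonneg χ.nonneg, norm_eq_abs]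
    exact (mul_le_of_le_one_left (abs_nonneg _) χ.le_one).trans (abs_aker_le γ z i j)
  · rw [Set.indicator_of_notMem hz, χ.zero_of_le_dist (by simpa using hz)]
    simp

lemma contDiff_one_sub_bump_mul_aker (γ : ℝ) (χ : ContDiffBump (0 : V3)) (i j : Fin 3) :
    ContDiff ℝ ∞ (fun z => (1 - χ z) * aker γ z i j) := by
  refine contDiff_iff_contDiffAt.2 fun z => ?_
  rcases eq_or_ne z 0 with rfl | hz
  · refine (contDiffAt_const (c := (0 : ℝ))).congr_of_eventuallyEq ?_
    filter_upwards [χ.eventuallyEq_one] with y hy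
    rw [hy]
    simp
  · exact (contDiffAt_const.sub χ.contDiffAt).mul (contDiffAt_aker γ hz i j)

/-! ### The convolution -/

lemma abar_eq_add {γ : ℝ} (hγ : -5 < γ) {i j : Fin 3} {χ : ContDiffBump (0 : V3)} {B : ℝ}
    (hB : ∀ z, ‖(1 - χ z) * aker γ z i j‖ ≤ B) (v : V3) :
    abar γ v i j = (∫ w, (χ w * aker γ w i j) • gaussM (v - w)) +
      ∫ w, gaussM w • ((1 - χ (v - w)) * aker γ (v - w) i j) := by
  obtain ⟨C, hC⟩ := norm_iteratedFDeriv_gaussM_le_rpow 0 0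
  simp only [norm_iteratedFDeriv_zero, rpow_zero, mul_one] at hC
  have h₁ := integrable_smul_comp_sub (integrable_bump_mul_aker hγ χ i j)
    contDiff_gaussM.continuous hC v
  have h₂ := integrable_smul_comp_sub integrable_gaussM
    (contDiff_one_sub_bump_mul_aker γ χ i j).continuous hB v
  have h₃ := h₁.comp_sub_left v
  rw [← integral_sub_left_eq_self (fun w => (χ w * aker γ w i j) • gaussM (v - w)) volume v,
    ← integral_add h₃ h₂, abar]
  refine integral_congr_ae (Eventually.of_forall fun w => ?_)
  simp only [sub_sub_cancel, smul_eq_mul]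
  ring

lemma exists_abar_bound {γ : ℝ} (hγ : γ ∈ Set.Ico (-3 : ℝ) (-2)) (i j : Fin 3) :
    ContDiff ℝ ∞ (fun v => abar γ v i j) ∧ ∀ n : ℕ, ∃ C, ∀ v,
      ‖iteratedFDeriv ℝ n (fun v => abar γ v i j) v‖ ≤ C * (1 + ‖v‖) ^ (γ + 2 - n) := by
  obtain ⟨hγ₁, hγ₂⟩ := hγ
  let χ : ContDiffBump (0 : V3) := ⟨1, 2, one_pos, one_lt_two⟩
  set g : V3 → ℝ := fun w => χ w * aker γ w i j with hg_def
  set h : V3 → ℝ := fun z => (1 - χ z) * aker γ z i j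
  have hg : Integrable g := integrable_bump_mul_aker (by linarith) χ i j
  have hh : ContDiff ℝ ∞ h := contDiff_one_sub_bump_mul_aker γ χ i j
  have hdecay := exists_norm_iteratedFDeriv_le_of_eq_homogeneous (h := h) (R := 2)
    (by linarith : γ + 2 ≤ 0) one_le_two (fun z hz => contDiffAt_aker γ hz i j)
    (fun t ht z => aker_smul hγ₂ ht z i j) hh fun z hz => by
      simp [h, χ.zero_of_le_dist (x := z) (by simpa using hz.le)]
  have hhB (k : ℕ) : ∃ B, ∀ z, ‖iteratedFDeriv ℝ k h z‖ ≤ B := by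
    obtain ⟨C, hC⟩ := hdecay k
    refine ⟨|C|, fun z => (hC z).trans ?_⟩
    have : (1 + ‖z‖) ^ (γ + 2 - k) ≤ 1 :=
      rpow_le_one_of_one_le_of_nonpos (by simp) (by have := k.cast_nonneg (α := ℝ); linarith)
    calc C * (1 + ‖z‖) ^ (γ + 2 - k) ≤ |C| * (1 + ‖z‖) ^ (γ + 2 - k) := by
          gcongr; exact le_abs_self C
      _ ≤ |C| := mul_le_of_le_one_right (abs_nonneg C) this
  have hGB (k : ℕ) : ∃ B, ∀ z, ‖iteratedFDeriv ℝ k gaussM z‖ ≤ B := by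
    simpa using norm_iteratedFDeriv_gaussM_le_rpow k 0
  have hsplit : (fun v => abar γ v i j) = fun v => (∫ w, g w • gaussM (v - w)) +
      ∫ w, gaussM w • h (v - w) := by
    obtain ⟨B, hB⟩ := hhB 0
    exact funext fun v => abar_eq_add (B := B) (by linarith)
      (fun z => by simpa only [norm_iteratedFDeriv_zero] using hB z) v
  have hs₁ : ContDiff ℝ ∞ fun v => ∫ w, g w • gaussM (v - w) :=
    contDiff_infty.2 fun n => (contDiff_integral_smul_comp_sub hg n contDiff_gaussM hGB).1
  have hs₂ : ContDiff ℝ ∞ fun v => ∫ w, gaussM w • h (v - w) :=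
    contDiff_infty.2 fun n => (contDiff_integral_smul_comp_sub integrable_gaussM n hh hhB).1
  rw [hsplit]
  refine ⟨hs₁.add hs₂, fun n => ?_⟩
  have hp : γ + 2 - n ≤ 0 := by have := n.cast_nonneg (α := ℝ); linarith
  obtain ⟨C₁, hC₁⟩ := norm_iteratedFDeriv_gaussM_le_rpow n (γ + 2 - n)
  obtain ⟨C₂, hC₂⟩ := hdecay n
  have hgp : Integrable fun w => ‖g w‖ * (1 + ‖w‖) ^ (-(γ + 2 - n)) := by
    refine (hg.norm.mul_const (3 ^ (-(γ + 2 - n)))).mono'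
      (hg.norm.aestronglyMeasurable.mul
        (continuous_one_add_norm_rpow _).aestronglyMeasurable) (Eventually.of_forall fun w => ?_)
    have h0 : 0 ≤ ‖g w‖ * (1 + ‖w‖) ^ (-(γ + 2 - n)) := by positivity
    rw [norm_of_nonneg h0]
    rcases le_or_gt 2 ‖w‖ with hw | hw
    · simp [hg_def, χ.zero_of_le_dist (x := w) (by simpa using hw)]
    · gcongr
      · linarith
      · linarith
  refine ⟨C₁ * (∫ w, ‖g w‖ * (1 + ‖w‖) ^ (-(γ + 2 - n))) +
    C₂ * ∫ w, ‖gaussM w‖ * (1 + ‖w‖) ^ (-(γ + 2 - n)), fun v => ?_⟩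
  rw [fun_iteratedFDeriv_add_apply (hs₁.of_le (mod_cast le_top)).contDiffAt
    (hs₂.of_le (mod_cast le_top)).contDiffAt, add_mul]
  exact (norm_add_le _ _).trans <| add_le_add
    (norm_iteratedFDeriv_integral_smul_comp_sub_le hg contDiff_gaussM hGB hp hgp hC₁ v)
    (norm_iteratedFDeriv_integral_smul_comp_sub_le integrable_gaussM hh hhB hp
      (integrable_gaussM_mul_rpow _) hC₂ v)

lemma jap_le_one_add_norm (v : V3) : jap v ≤ 1 + ‖v‖ :=
  sqrt_le_iff.2 ⟨by positivity, by nlinarith [norm_nonneg v]⟩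

lemma jap_pos (v : V3) : 0 < jap v :=
  sqrt_pos.2 (by positivity)

/-- Lemma 2.1 (b), first part: ā_{ij} is smooth with |∂^n ā_{ij}(v)| ≤ C_n ⟨v⟩^{γ+2−n}. -/
theorem stmt1 (γ : ℝ) (hγ : γ ∈ Set.Ico (-3 : ℝ) (-2)) :
    (∀ i j : Fin 3, ContDiff ℝ (⊤ : ℕ∞) (fun v => abar γ v i j)) ∧
    ∀ n : ℕ, ∃ C > (0 : ℝ), ∀ (v : V3) (i j : Fin 3),
      ‖iteratedFDeriv ℝ n (fun v => abar γ v i j) v‖ ≤ C * jap v ^ (γ + 2 - n) := by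
  refine ⟨fun i j => (exists_abar_bound hγ i j).1, fun n => ?_⟩
  choose C hC using fun i j => (exists_abar_bound hγ i j).2 n
  refine ⟨1 + ∑ i, ∑ j, |C i j|, by positivity, fun v i j => (hC i j v).trans ?_⟩
  have hCij : C i j ≤ 1 + ∑ i, ∑ j, |C i j| := by
    have h₁ : |C i j| ≤ ∑ j, |C i j| :=
      Finset.single_le_sum (f := fun j => |C i j|) (fun _ _ => abs_nonneg _) (Finset.mem_univ j)
    have h₂ : ∑ j, |C i j| ≤ ∑ i, ∑ j, |C i j| :=
      Finset.single_le_sum (f := fun i => ∑ j, |C i j|)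
        (fun _ _ => Finset.sum_nonneg fun _ _ => abs_nonneg _) (Finset.mem_univ i)
    linarith [le_abs_self (C i j)]
  have hp : γ + 2 - n ≤ 0 := by
    have := n.cast_nonneg (α := ℝ)
    linarith [hγ.2]
  exact mul_le_mul hCij (rpow_le_rpow_of_nonpos (jap_pos v) (jap_le_one_add_norm v) hp)
    (by positivity) (by positivity)
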